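/- arXiv:2210.07961 — 8 statements merged into one kernel-verified Lean document; each statement's English description precedes it below -/
import Mathlib

section
/- Let x = (x_0, ..., x_n) be a tuple of nonzero integers with weights w = (q_0, ..., q_n). For any prime p, the exponent of p in the prime factorization of wgcd_w(x) equals min over i = 0, ..., n of floor(α_i / q_i), where α_i is the exponent of p in the prime factorization of |x_i| (i.e. the p-adic valuation of x_i). Equivalently, wgcd_w(x) = ∏_p p^{min_i ⌊v_p(x_i)/q_i⌋}, the product running over all primes p. -/
/-- The weighted greatest common divisor of a tuple `x` of integers with respect to
weights `w`: the largest positive integer `d` such that `d ^ (w i) ∣ x i` for all `i`. -/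
noncomputable def wgcd {n : ℕ} (w : Fin n → ℕ) (x : Fin n → ℤ) : ℕ :=
  sSup {d : ℕ | 0 < d ∧ ∀ i, (d : ℤ) ^ (w i) ∣ x i}

/-- A power `d ^ k` divides a nonzero natural number exactly when `k * v_p(d) ≤ v_p(m)` for
all `p`. -/
theorem pow_dvd_iff_forall_mul_factorization_le {d m : ℕ} (k : ℕ) (hd : d ≠ 0) (hm : m ≠ 0) :
    d ^ k ∣ m ↔ ∀ p, k * d.factorization p ≤ m.factorization p := by
  rw [← Nat.factorization_le_iff_dvd (pow_ne_zero k hd) hm, Nat.factorization_pow]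
  exact Finsupp.le_def

theorem natCast_pow_dvd_iff_pow_dvd_natAbs (d k : ℕ) (z : ℤ) :
    (d : ℤ) ^ k ∣ z ↔ d ^ k ∣ z.natAbs := by
  rw [← Int.natCast_dvd, Nat.cast_pow]

theorem bddAbove_setOf_pow_dvd {n : ℕ} {w : Fin n → ℕ} {x : Fin n → ℤ} (i : Fin n)
    (hw : 0 < w i) (hx : x i ≠ 0) :
    BddAbove {d : ℕ | 0 < d ∧ ∀ i, (d : ℤ) ^ (w i) ∣ x i} := by
  refine ⟨(x i).natAbs, fun d hd => ?_⟩
  have h := (natCast_pow_dvd_iff_pow_dvd_natAbs d (w i) (x i)).1 (hd.2 i)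
  exact (Nat.le_self_pow hw.ne' d).trans (Nat.le_of_dvd (Int.natAbs_pos.2 hx) h)

/-- for a tuple of nonzero integers, the exponent of a prime `p` in the
prime factorization of `wgcd w x` is `min i, ⌊v_p (x i) / w i⌋`, where `v_p (x i)` is
the exponent of `p` in the prime factorization of `|x i|`. -/
theorem wgcd_factorization (n : ℕ) (x : Fin (n + 1) → ℤ) (w : Fin (n + 1) → ℕ)
    (hw : ∀ i, 0 < w i) (hx : ∀ i, x i ≠ 0) (p : ℕ) (hp : p.Prime) :
    (wgcd w x).factorization p =
      Finset.univ.inf' Finset.univ_nonempty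
        (fun i => (x i).natAbs.factorization p / w i) := by
  have hbdd := bddAbove_setOf_pow_dvd 0 (hw 0) (hx 0)
  have hx' : ∀ i, (x i).natAbs ≠ 0 := fun i => Int.natAbs_ne_zero.2 (hx i)
  obtain ⟨hpos, hdvd⟩ : 0 < wgcd w x ∧ ∀ i, (wgcd w x : ℤ) ^ (w i) ∣ x i :=
    Nat.sSup_mem ⟨1, by simp⟩ hbdd
  have hle : ∀ i q, w i * (wgcd w x).factorization q ≤ (x i).natAbs.factorization q := fun i =>
    (pow_dvd_iff_forall_mul_factorization_le (w i) hpos.ne' (hx' i)).1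
      ((natCast_pow_dvd_iff_pow_dvd_natAbs _ _ _).1 (hdvd i))
  apply le_antisymm
  · refine Finset.le_inf' _ _ fun i _ => ?_
    rw [Nat.le_div_iff_mul_le (hw i), mul_comm]
    exact hle i p
  · by_contra! hlt
    rw [Finset.lt_inf'_iff] at hlt
    have hmem : p * wgcd w x ≤ wgcd w x := by
      refine le_csSup hbdd ⟨Nat.mul_pos hp.pos hpos, fun i => ?_⟩
      rw [natCast_pow_dvd_iff_pow_dvd_natAbs,
        pow_dvd_iff_forall_mul_factorization_le _ (Nat.mul_pos hp.pos hpos).ne' (hx' i)]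
      intro q
      rw [Nat.factorization_mul hp.ne_zero hpos.ne', Finsupp.add_apply, hp.factorization]
      obtain rfl | hq := eq_or_ne p q
      · have h := (Nat.le_div_iff_mul_le (hw i)).1 (Nat.succ_le_of_lt (hlt i (Finset.mem_univ i)))
        rw [Finsupp.single_eq_same, add_comm, mul_comm]
        exact h
      · rw [Finsupp.single_eq_of_ne hq.symm, zero_add]
        exact hle i q
    exact absurd hmem (not_le.2 (lt_mul_of_one_lt_left hpos hp.one_lt))
end

section
/- Let x = (x_0, ..., x_n) be a tuple of integers (n ≥ 1) with weights w = (q_0, ..., q_n). Fix an index i with 0 ≤ i ≤ n, let x^i = (x_0, ..., x_{i-1}, x_{i+1}, ..., x_n) be the tuple obtained by deleting the i-th coordinate, and w^i = (q_0, ..., q_{i-1}, q_{i+1}, ..., q_n) the corresponding weights. Assume the coordinates of x^i are not all zero. Then wgcd_w(x) = wgcd_{(1, q_i)}( wgcd_{w^i}(x^i), x_i ), i.e. the weighted gcd of x equals the weighted gcd of the pair (wgcd_{w^i}(x^i), x_i) with respect to the weights (1, q_i). -/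
theorem wgcd_bddAbove {n : ℕ} {w : Fin n → ℕ} {x : Fin n → ℤ} (hw : ∀ j, 0 < w j)
    (hx : ∃ j, x j ≠ 0) :
    BddAbove {d : ℕ | 0 < d ∧ ∀ i, (d : ℤ) ^ (w i) ∣ x i} := by
  obtain ⟨j, hj⟩ := hx
  refine ⟨(x j).natAbs, fun d ⟨_, hd⟩ => ?_⟩
  have h : ((d : ℕ) : ℤ) ∣ x j := (dvd_pow_self _ (hw j).ne').trans (hd j)
  exact Nat.le_of_dvd (Int.natAbs_pos.mpr hj) (Int.natCast_dvd.mp h)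

theorem wgcd_mem {n : ℕ} {w : Fin n → ℕ} {x : Fin n → ℤ} (hw : ∀ j, 0 < w j)
    (hx : ∃ j, x j ≠ 0) :
    0 < wgcd w x ∧ ∀ i, (wgcd w x : ℤ) ^ (w i) ∣ x i :=
  Nat.sSup_mem (s := {d : ℕ | 0 < d ∧ ∀ i, (d : ℤ) ^ (w i) ∣ x i})
    ⟨1, by simp⟩ (wgcd_bddAbove hw hx)

theorem lcm_pow_dvd {a b q : ℕ} {y : ℤ} (ha : (a : ℤ) ^ q ∣ y) (hb : (b : ℤ) ^ q ∣ y) :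
    ((a.lcm b : ℕ) : ℤ) ^ q ∣ y := by
  rw [← Nat.cast_pow, Int.natCast_dvd] at *
  rw [← Nat.pow_lcm_pow]
  exact Nat.lcm_dvd ha hb

/-- The positive divisors of the weighted gcd are exactly the weighted common divisors. -/
theorem dvd_wgcd_iff {n : ℕ} {w : Fin n → ℕ} {x : Fin n → ℤ} (hw : ∀ j, 0 < w j)
    (hx : ∃ j, x j ≠ 0) {d : ℕ} (hd : 0 < d) :
    d ∣ wgcd w x ↔ ∀ i, (d : ℤ) ^ (w i) ∣ x i := by
  obtain ⟨hpos, hdvd⟩ := wgcd_mem hw hx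
  refine ⟨fun h i => (pow_dvd_pow_of_dvd (Int.natCast_dvd_natCast.mpr h) _).trans (hdvd i),
    fun h => ?_⟩
  have hle : d.lcm (wgcd w x) ≤ wgcd w x :=
    le_csSup (wgcd_bddAbove hw hx)
      ⟨Nat.lcm_pos hd hpos, fun i => lcm_pow_dvd (h i) (hdvd i)⟩
  have heq : d.lcm (wgcd w x) = wgcd w x :=
    hle.antisymm (Nat.le_of_dvd (Nat.lcm_pos hd hpos) (Nat.dvd_lcm_right _ _))
  exact heq ▸ Nat.dvd_lcm_left d (wgcd w x)

/-- deleting the `i`-th coordinate, the weighted gcd of `x` equals the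
weighted gcd of the pair `(wgcd of the deleted tuple, x i)` with weights `(1, w i)`. -/
theorem wgcd_delete (n : ℕ) (x : Fin (n + 2) → ℤ) (w : Fin (n + 2) → ℕ) (i : Fin (n + 2))
    (hw : ∀ j, 0 < w j) (hx : ∃ j : Fin (n + 1), x (i.succAbove j) ≠ 0) :
    wgcd w x =
      wgcd ![1, w i]
        ![(wgcd (fun j => w (i.succAbove j)) (fun j => x (i.succAbove j)) : ℤ), x i] := by
  conv_lhs => unfold wgcd
  conv_rhs => rw [wgcd]
  congr 1
  ext d
  refine and_congr_right fun hd => ?_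
  rw [Fin.forall_fin_two, Fin.forall_iff_succAbove i,
    ← dvd_wgcd_iff (fun j => hw (i.succAbove j)) hx hd]
  simp [and_comm, Int.natCast_dvd_natCast]
end

section
/- Let (x_0, x_1) be a pair of integers with weights (q_0, q_1) such that q_0 ≤ q_1, and assume x_0 - x_1 and x_1 are not both zero. Then wgcd_{(q_0,q_1)}(x_0, x_1) = wgcd_{(q_0,q_1)}(x_0 - x_1, x_1). -/
/-- if `q₀ ≤ q₁` then `wgcd (x₀, x₁) = wgcd (x₀ - x₁, x₁)`. -/
theorem wgcd_sub_left (x₀ x₁ : ℤ) (q₀ q₁ : ℕ) (hq₀ : 0 < q₀) (hq₁ : 0 < q₁)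
    (hq : q₀ ≤ q₁) (hx : ¬(x₀ - x₁ = 0 ∧ x₁ = 0)) :
    wgcd ![q₀, q₁] ![x₀, x₁] = wgcd ![q₀, q₁] ![x₀ - x₁, x₁] := by
  unfold wgcd
  congr 1
  ext d
  simp only [Set.mem_ofPred_eq, Fin.forall_fin_two, Matrix.cons_val_zero, Matrix.cons_val_one]
  refine and_congr_right fun _ => and_congr_left fun h => ?_
  exact (dvd_sub_left ((pow_dvd_pow _ hq).trans h)).symm
end

section
/- Let (x_0, x_1) be a pair of integers, not both zero, with weights (q_0, q_1) such that q_0 ≤ q_1. Then wgcd_{(q_0,q_1)}(x_0, x_1) = wgcd_{(q_0,q_1)}(x_1 - x_0, x_1). -/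
/-- if `q₀ ≤ q₁` then `wgcd (x₀, x₁) = wgcd (x₁ - x₀, x₁)`. -/
theorem wgcd_sub_swap (x₀ x₁ : ℤ) (q₀ q₁ : ℕ) (hq₀ : 0 < q₀) (hq₁ : 0 < q₁)
    (hq : q₀ ≤ q₁) (hx : ¬(x₀ = 0 ∧ x₁ = 0)) :
    wgcd ![q₀, q₁] ![x₀, x₁] = wgcd ![q₀, q₁] ![x₁ - x₀, x₁] := by
  unfold wgcd
  congr 1
  ext d
  simp only [Set.mem_ofPred_eq, Fin.forall_fin_two, Matrix.cons_val_zero, Matrix.cons_val_one]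
  refine and_congr_right fun _ => and_congr_left fun h => ?_
  exact (dvd_sub_right ((pow_dvd_pow _ hq).trans h)).symm
end

section
/- Let (x_0, x_1) be a pair of integers, not both zero, with weights (q_0, q_1) such that q_0 < q_1. Then wgcd_{(q_0,q_1)}(x_0, x_1) = wgcd_{(q_0,q_1)}( gcd(x_0, x_1), x_1 ), where gcd(x_0, x_1) is the ordinary (nonnegative) greatest common divisor of x_0 and x_1. -/
/-- if `q₀ < q₁` then `wgcd (x₀, x₁) = wgcd (gcd (x₀, x₁), x₁)`, where
`gcd` is the ordinary nonnegative greatest common divisor. -/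
theorem wgcd_gcd_left (x₀ x₁ : ℤ) (q₀ q₁ : ℕ) (hq₀ : 0 < q₀) (hq : q₀ < q₁)
    (hx : ¬(x₀ = 0 ∧ x₁ = 0)) :
    wgcd ![q₀, q₁] ![x₀, x₁] = wgcd ![q₀, q₁] ![(Int.gcd x₀ x₁ : ℤ), x₁] := by
  unfold wgcd
  congr 1
  ext d
  simp only [Set.mem_ofPred_eq, Fin.forall_fin_two, Matrix.cons_val_zero, Matrix.cons_val_one]
  refine and_congr_right fun _ => and_congr_left fun h₁ => ?_
  exact ⟨fun h₀ => Int.dvd_coe_gcd h₀ ((pow_dvd_pow _ hq.le).trans h₁),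
    fun h => h.trans (Int.gcd_dvd_left x₀ x₁)⟩
end

section
/- Let (x_0, x_1) be a pair of integers with weights (q_0, q_1) such that q_0 < q_1, and suppose x_0 > x_1 > 0. Write x_0 = r·x_1 + α with 0 ≤ α < x_1 (Euclidean division of x_0 by x_1, so α = x_0 mod x_1). Then wgcd_{(q_0,q_1)}(x_0, x_1) = wgcd_{(q_0,q_1)}(α, x_1). -/
/-- if `q₀ < q₁` and `x₀ > x₁ > 0`, then with `α = x₀ % x₁` (the
remainder of the Euclidean division of `x₀` by `x₁`),
`wgcd (x₀, x₁) = wgcd (α, x₁)`. -/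
theorem wgcd_mod_left (x₀ x₁ : ℤ) (q₀ q₁ : ℕ) (hq₀ : 0 < q₀) (hq : q₀ < q₁)
    (h₁ : x₀ > x₁) (h₂ : x₁ > 0) :
    wgcd ![q₀, q₁] ![x₀, x₁] = wgcd ![q₀, q₁] ![x₀ % x₁, x₁] := by
  unfold wgcd
  congr 1
  ext d
  simp only [Set.mem_ofPred_eq, Fin.forall_fin_two, Matrix.cons_val_zero, Matrix.cons_val_one]
  refine and_congr_right fun _ => and_congr_left fun h => ?_
  exact (EuclideanDomain.dvd_mod_iff ((pow_dvd_pow _ hq.le).trans h)).symm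
end

section
/- Let x = (x_0, x_1, ..., x_n) be a tuple of integers, not all zero, with weights w = (q_0, q_1, ..., q_n) satisfying q_0 < q_1 < ... < q_n. Then wgcd_w(x_0, x_1, ..., x_n) = wgcd_w( gcd(x_0, x_1, ..., x_n), x_1, ..., x_n ), i.e. replacing the first coordinate x_0 by the ordinary greatest common divisor of all the coordinates does not change the weighted greatest common divisor. -/
/-- If the weight `w i₀` is minimal, then replacing the coordinate `x i₀` by the gcd of all
coordinates does not change which `d` satisfy `d ^ w i ∣ x i` for all `i`. -/
theorem forall_pow_dvd_update_gcd_iff {ι : Type*} [Fintype ι] [DecidableEq ι] {w : ι → ℕ} {i₀ : ι}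
    (hw : ∀ i, w i₀ ≤ w i) (x : ι → ℤ) (d : ℤ) :
    (∀ i, d ^ w i ∣ Function.update x i₀ (Finset.univ.gcd x) i) ↔ ∀ i, d ^ w i ∣ x i := by
  rw [Function.forall_update_iff x fun i a => d ^ w i ∣ a]
  constructor
  · rintro ⟨h₀, h⟩ i
    by_cases hi : i = i₀
    · subst hi
      exact h₀.trans (Finset.gcd_dvd (Finset.mem_univ i))
    · exact h i hi
  · exact fun h => ⟨Finset.dvd_gcd fun i _ => (pow_dvd_pow d (hw i)).trans (h i), fun i _ => h i⟩

/-- with strictly increasing weights, replacing the first coordinate by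
the ordinary gcd of all coordinates does not change the weighted gcd. -/
theorem wgcd_update_gcd (n : ℕ) (x : Fin (n + 1) → ℤ) (w : Fin (n + 1) → ℕ)
    (hw₀ : ∀ i, 0 < w i) (hw : StrictMono w) (hx : ∃ i, x i ≠ 0) :
    wgcd w x = wgcd w (Function.update x 0 (Finset.univ.gcd x : ℤ)) := by
  simp only [wgcd, forall_pow_dvd_update_gcd_iff fun i => hw.monotone (Fin.zero_le i)]
end

section
/- Let x = (x_0, ..., x_n) be a tuple of integers, not all zero, with weights w = (q_0, ..., q_n) satisfying q_0 < q_1 < ... < q_n. Define y_i = gcd(x_i, x_{i+1}, ..., x_n) for i = 0, ..., n (so y_0 = gcd(x_0, ..., x_n), y_{n-1} = gcd(x_{n-1}, x_n), and y_n = x_n). Then wgcd_w(x_0, ..., x_n) = wgcd_w(y_0, y_1, ..., y_n). -/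
/-- For monotone weights, the powers `d ^ w i` divide the coordinates `x i` if and only if
they divide the gcds of the tail segments of `x`. -/
theorem forall_pow_dvd_gcd_Ici_iff {n : ℕ} {w : Fin n → ℕ} (hw : Monotone w)
    (x : Fin n → ℤ) (d : ℤ) :
    (∀ i, d ^ w i ∣ (Finset.Ici i).gcd x) ↔ ∀ i, d ^ w i ∣ x i := by
  simp only [Finset.dvd_gcd_iff, Finset.mem_Ici]
  exact ⟨fun h i => h i i le_rfl, fun h i j hij => (pow_dvd_pow d (hw hij)).trans (h j)⟩

/-- with strictly increasing weights, replacing each coordinate `x i` by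
`y i = gcd (x i, x (i+1), …, x n)`, the gcd of the tail segment starting at `i`,
does not change the weighted gcd. -/
theorem wgcd_tails (n : ℕ) (x : Fin (n + 1) → ℤ) (w : Fin (n + 1) → ℕ)
    (hw₀ : ∀ i, 0 < w i) (hw : StrictMono w) (hx : ∃ i, x i ≠ 0)
    (y : Fin (n + 1) → ℤ) (hy : ∀ i, y i = (Finset.Ici i).gcd x) :
    wgcd w x = wgcd w y := by
  simp only [wgcd, hy, forall_pow_dvd_gcd_Ici_iff hw.monotone]
end
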